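/- arXiv:0805.1968 — 3 statements merged into one kernel-verified Lean document; each statement's English description precedes it below -/
import Mathlib

section
/- Let {X_n}_{n≥1} be a stationary sequence of real-valued random variables, and fix an integer m ≥ 1. Define the partial sums S_0 = 0, S_n = Σ_{i=1}^n X_i for n ≥ 1, and the subsampled sums S_n^{(m)} = Σ_{i=0}^{⌊n/m⌋} X_{im+1} for n ≥ 0. Then for every x > 0, P[sup_{n≥0} S_n > x] ≤ m · P[sup_{n≥0} S_n^{(m)} > x/m]. -/
open MeasureTheory ProbabilityTheory Filter

theorem aux_residue_sum (f : ℕ → ℝ) (m n j : ℕ) (hj : j < m) :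
    ∑ i ∈ (Finset.range n).filter (fun i => i % m = j), f i
      = ∑ i ∈ Finset.range ((n + m - 1 - j) / m), f (i * m + j) := by
  have hm : 0 < m := by omega
  have key : ∀ i, i < (n + m - 1 - j) / m ↔ i * m + j < n := by
    intro i
    rw [← Nat.succ_le_iff, Nat.le_div_iff_mul_le hm, Nat.succ_mul]
    omega
  have hdm : ∀ a, a % m = j → a / m * m + j = a := by
    intro a ha
    have := Nat.div_add_mod a m
    rw [ha, mul_comm] at this
    exact this
  refine Finset.sum_nbij' (fun i => i / m) (fun i => i * m + j) ?_ ?_ ?_ ?_ ?_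
  · intro a ha
    simp only [Finset.mem_filter, Finset.mem_range] at ha ⊢
    rw [key, hdm a ha.2]
    exact ha.1
  · intro a ha
    simp only [Finset.mem_filter, Finset.mem_range] at ha ⊢
    refine ⟨(key a).1 ha, ?_⟩
    rw [mul_comm, Nat.mul_add_mod, Nat.mod_eq_of_lt hj]
  · intro a ha
    simp only [Finset.mem_filter, Finset.mem_range] at ha
    exact hdm a ha.2
  · intro a ha
    show (a * m + j) / m = a
    rw [mul_comm, Nat.mul_add_div hm, Nat.div_eq_of_lt hj, add_zero]
  · intro a ha
    simp only [Finset.mem_filter, Finset.mem_range] at ha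
    rw [hdm a ha.2]

theorem aux_shift {Ω : Type*} [MeasurableSpace Ω] (μ : Measure Ω)
    (X : ℕ → Ω → ℝ) (hmeas : ∀ n, Measurable (X n))
    (hstat : μ.map (fun ω => fun n : ℕ => X (n + 1) ω)
        = μ.map (fun ω => fun n : ℕ => X n ω)) (j : ℕ) :
    μ.map (fun ω => fun n : ℕ => X (n + j) ω) = μ.map (fun ω => fun n : ℕ => X n ω) := by
  induction j with
  | zero => rfl
  | succ j ih =>
    have hg : Measurable (fun (f : ℕ → ℝ) (n : ℕ) => f (n + j)) :=
      measurable_pi_lambda _ fun n => measurable_pi_apply _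
    have h := congrArg (Measure.map (fun (f : ℕ → ℝ) (n : ℕ) => f (n + j))) hstat
    rw [Measure.map_map hg (measurable_pi_lambda _ fun n => hmeas _),
      Measure.map_map hg (measurable_pi_lambda _ fun n => hmeas _)] at h
    exact h.trans ih

/-- **Subsampling bound for suprema of stationary partial sums.**
Here `X 0, X 1, …` represents the stationary sequence `X_1, X_2, …`, so that
`S_n = ∑_{i<n} X i` and `S_n^{(m)} = ∑_{i=0}^{⌊n/m⌋} X_{im+1} = ∑_{i≤⌊n/m⌋} X (i*m)`.
Stationarity is expressed as equality in law of the shifted sequence. -/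
theorem stationary_subsampling_bound
    {Ω : Type*} [MeasurableSpace Ω] (μ : Measure Ω) [IsProbabilityMeasure μ]
    (X : ℕ → Ω → ℝ) (hmeas : ∀ n, Measurable (X n))
    (hstat : μ.map (fun ω => fun n : ℕ => X (n + 1) ω)
        = μ.map (fun ω => fun n : ℕ => X n ω))
    (m : ℕ) (hm : 1 ≤ m) :
    ∀ x : ℝ, 0 < x →
      μ {ω | ∃ n : ℕ, x < ∑ i ∈ Finset.range n, X i ω}
        ≤ (m : ENNReal) *
          μ {ω | ∃ n : ℕ, x / (m : ℝ) < ∑ i ∈ Finset.range (n / m + 1), X (i * m) ω} := by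
  intro x hx
  have hm0 : (0 : ℝ) < m := by exact_mod_cast hm
  let A : Set (ℕ → ℝ) :=
    {f | ∃ n : ℕ, x / (m : ℝ) < ∑ i ∈ Finset.range (n / m + 1), f (i * m)}
  have hA : MeasurableSet A := by
    have : A = ⋃ n : ℕ,
        {f : ℕ → ℝ | x / (m : ℝ) < ∑ i ∈ Finset.range (n / m + 1), f (i * m)} := by
      ext f; simp [A]
    rw [this]
    refine MeasurableSet.iUnion fun n => measurableSet_lt measurable_const ?_
    exact Finset.measurable_sum _ fun i _ => measurable_pi_apply _
  have hB : ∀ j, μ ((fun ω => fun n : ℕ => X (n + j) ω) ⁻¹' A)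
      = μ ((fun ω => fun n : ℕ => X n ω) ⁻¹' A) := by
    intro j
    rw [← Measure.map_apply (measurable_pi_lambda _ fun n => hmeas _) hA,
      ← Measure.map_apply (measurable_pi_lambda _ fun n => hmeas _) hA,
      aux_shift μ X hmeas hstat j]
  have hsub : {ω | ∃ n : ℕ, x < ∑ i ∈ Finset.range n, X i ω}
      ⊆ ⋃ j ∈ Finset.range m, (fun ω => fun n : ℕ => X (n + j) ω) ⁻¹' A := by
    rintro ω ⟨n, hn⟩
    rw [← Finset.sum_fiberwise_of_maps_to (s := Finset.range n) (t := Finset.range m)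
      (g := fun i => i % m) (fun i _ => Finset.mem_range.2 (Nat.mod_lt _ hm))] at hn
    have hx' : x = ∑ j ∈ Finset.range m, x / (m : ℝ) := by
      rw [Finset.sum_const, Finset.card_range, nsmul_eq_mul]
      field_simp
    rw [hx'] at hn
    obtain ⟨j, hj, hlt⟩ := Finset.exists_lt_of_sum_lt hn
    rw [aux_residue_sum (fun i => X i ω) m n j (Finset.mem_range.1 hj)] at hlt
    refine Set.mem_iUnion₂.2 ⟨j, hj, ?_⟩
    generalize (n + m - 1 - j) / m = k at hlt
    cases k with
    | zero =>
      have : 0 < x / (m : ℝ) := div_pos hx hm0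
      simp at hlt
      linarith
    | succ k =>
      refine ⟨k * m, ?_⟩
      rw [Nat.mul_div_cancel _ hm]
      exact hlt
  calc _ ≤ _ := measure_mono hsub
    _ ≤ ∑ j ∈ Finset.range m, μ ((fun ω => fun n : ℕ => X (n + j) ω) ⁻¹' A) :=
      measure_biUnion_finset_le _ _
    _ = (m : ENNReal) * μ ((fun ω => fun n : ℕ => X n ω) ⁻¹' A) := by
      simp only [hB, Finset.sum_const, Finset.card_range, nsmul_eq_mul]
end

section
/- Let {X_n}_{n≥1} be a stationary m-dependent sequence of integrable real-valued random variables with E[X_1] = −δ < 0, whose marginal tail is regularly varying: P[X_1 > x] = l(x)/x^α with α > 1 and l slowly varying. Let S_n = Σ_{i=1}^n X_i. Then there exists a constant C > 0, not depending on H, such that for every H ≥ 1: limsup_{x→∞} P[sup_{n ≥ ⌈Hx⌉} S_n > x] / ∫_x^∞ P[X_1 > u] du ≤ C / H^{α−1}. -/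
open MeasureTheory ProbabilityTheory Filter

lemma lt_map_eq {Ω : Type*} [MeasurableSpace Ω] (μ : Measure Ω) 
    (X : ℕ → Ω → ℝ) (hmeas : ∀ n, Measurable (X n)) 
    (hstat : μ.map (fun ω => fun n : ℕ => X (n + 1) ω)
        = μ.map (fun ω => fun n : ℕ => X n ω)) (i : ℕ) : μ.map (X i) = μ.map (X 0) := by
  induction i with
  | zero => rfl
  | succ i ih =>
    rw [← ih]
    have h := congrArg (fun ν => ν.map (fun f : ℕ → ℝ => f i)) hstat
    rw [Measure.map_map (by fun_prop) (by fun_prop), Measure.map_map (by fun_prop) (by fun_prop)] at h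
    exact h

lemma lt_prod {Ω : Type*} [MeasurableSpace Ω] (μ : Measure Ω) [IsProbabilityMeasure μ]
    (X : ℕ → Ω → ℝ) (hmeas : ∀ n, Measurable (X n)) (m : ℕ)
    (hlaw : ∀ i, μ.map (X i) = μ.map (X 0))
    (hmdep : ∀ n : ℕ, ProbabilityTheory.Indep
        (MeasurableSpace.comap (X n) inferInstance)
        (⨆ i ∈ {i : ℕ | i + m < n}, MeasurableSpace.comap (X i) inferInstance) μ)
    (g : ℝ → ENNReal) (hg : Measurable g) (j n : ℕ) :
    ∫⁻ ω, ∏ i ∈ (Finset.range n).filter (fun i => i % (m+1) = j), g (X i ω) ∂μ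
      = (∫⁻ ω, g (X 0 ω) ∂μ) ^ ((Finset.range n).filter (fun i => i % (m+1) = j)).card := by
  induction n with
  | zero => simp
  | succ n ih =>
    rw [Finset.range_add_one, Finset.filter_insert]
    split_ifs with hn
    · have hnm : n ∉ (Finset.range n).filter (fun i => i % (m+1) = j) := by simp
      simp_rw [Finset.prod_insert hnm]
      rw [Finset.card_insert_of_notMem hnm, pow_succ, ← ih, mul_comm]
      have hle : (⨆ i ∈ {i : ℕ | i + m < n}, MeasurableSpace.comap (X i) inferInstance) ≤ (inferInstance : MeasurableSpace Ω) :=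
        iSup₂_le fun i _ => (hmeas i).comap_le
      rw [lintegral_mul_eq_lintegral_mul_lintegral_of_independent_measurableSpace (f := fun ω => g (X n ω)) (hmeas n).comap_le hle (hmdep n)
        (hg.comp (comap_measurable _))]
      · congr 1
        rw [← lintegral_map hg (hmeas n), hlaw n, lintegral_map hg (hmeas 0)]
      · refine Finset.measurable_prod _ fun i hi => hg.comp ?_
        simp only [Finset.mem_filter, Finset.mem_range] at hi
        have him : i + m < n := by
          by_contra hc
          have h1 : n - i < m + 1 := by omega
          have h2 : (n - i) % (m+1) = 0 := by
            apply (Nat.sub_mod_eq_zero_of_mod_eq); omega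
          rw [Nat.mod_eq_of_lt h1] at h2
          omega
        exact (comap_measurable (X i)).mono (le_iSup₂_of_le i him le_rfl) le_rfl
    · exact ih

lemma lt_card (d j n : ℕ) (hd : 0 < d) (hj : j < d) :
    n / d ≤ ((Finset.range n).filter (fun i => i % d = j)).card := by
  apply Finset.le_card_of_inj_on_range (fun k => k * d + j)
  · intro k hk
    simp only [Finset.mem_filter, Finset.mem_range]
    constructor
    · have : (k+1) * d ≤ n := (Nat.mul_le_mul_right d hk).trans (Nat.div_mul_le_self n d)
      nlinarith
    · rw [Nat.mul_add_mod_self_right, Nat.mod_eq_of_lt hj]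
  · intro a _ b _ h
    simp only [add_left_inj] at h
    exact Nat.eq_of_mul_eq_mul_right hd h

/-- Chernoff bound for the partial sums of a truncation. -/
lemma lt_chernoff {Ω : Type*} [MeasurableSpace Ω] (μ : Measure Ω) [IsProbabilityMeasure μ]
    (X : ℕ → Ω → ℝ) (hmeas : ∀ n, Measurable (X n)) (m : ℕ)
    (hlaw : ∀ i, μ.map (X i) = μ.map (X 0))
    (hmdep : ∀ n : ℕ, ProbabilityTheory.Indep
        (MeasurableSpace.comap (X n) inferInstance)
        (⨆ i ∈ {i : ℕ | i + m < n}, MeasurableSpace.comap (X i) inferInstance) μ)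
    (h b q : ℝ) (hh : 0 ≤ h) (hq : q ≤ 1) 
    (hE : ∫⁻ ω, ENNReal.ofReal (Real.exp (h * min (X 0 ω) b)) ∂μ ≤ ENNReal.ofReal q) (n : ℕ) :
    μ {ω | 0 < ∑ i ∈ Finset.range n, min (X i ω) b} ≤ (m+1) * ENNReal.ofReal q ^ (n / (m+1)) := by
  have hsub : {ω | 0 < ∑ i ∈ Finset.range n, min (X i ω) b} ⊆
      ⋃ j ∈ Finset.range (m+1), {ω | 1 ≤ ∏ i ∈ (Finset.range n).filter (fun i => i % (m+1) = j),
        ENNReal.ofReal (Real.exp (h * min (X i ω) b))} := by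
    intro ω hω
    simp only [Set.mem_ofPred_eq] at hω
    rw [← Finset.sum_fiberwise_of_maps_to (s := Finset.range n) (t := Finset.range (m+1)) (g := fun i => i % (m+1))
      (fun i _ => Finset.mem_range.2 (Nat.mod_lt _ (Nat.succ_pos m)))] at hω
    obtain ⟨j, hj, hpos⟩ := Finset.exists_lt_of_sum_lt (s := Finset.range (m+1)) (f := fun _ => (0:ℝ)) (by simpa using hω)
    simp only [Set.mem_iUnion]
    refine ⟨j, hj, ?_⟩
    simp only [Set.mem_ofPred_eq]
    rw [← ENNReal.ofReal_prod_of_nonneg (fun _ _ => (Real.exp_pos _).le), ← Real.exp_sum, ENNReal.one_le_ofReal,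
      ← Finset.mul_sum]
    exact Real.one_le_exp (mul_nonneg hh hpos.le)
  refine (measure_mono hsub).trans ((measure_biUnion_finset_le _ _).trans ?_)
  have hb : ∀ j ∈ Finset.range (m+1), μ {ω | 1 ≤ ∏ i ∈ (Finset.range n).filter (fun i => i % (m+1) = j),
        ENNReal.ofReal (Real.exp (h * min (X i ω) b))} ≤ ENNReal.ofReal q ^ (n / (m+1)) := by
    intro j hj
    have hg : Measurable (fun x : ℝ => ENNReal.ofReal (Real.exp (h * min x b))) := by fun_prop
    have hmk := mul_meas_ge_le_lintegral (μ := μ) (f := fun ω => ∏ i ∈ (Finset.range n).filter (fun i => i % (m+1) = j),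
        ENNReal.ofReal (Real.exp (h * min (X i ω) b))) (Finset.measurable_prod _ fun i _ => hg.comp (hmeas i)) 1
    rw [one_mul] at hmk
    refine hmk.trans ?_
    rw [lt_prod μ X hmeas m hlaw hmdep _ hg j n]
    have hq1 : ENNReal.ofReal q ≤ 1 := by simpa using hq
    exact (pow_le_pow_left' hE _).trans (pow_le_pow_right_of_le_one' hq1 (lt_card _ j n (Nat.succ_pos m) (Finset.mem_range.1 hj)))
  refine (Finset.sum_le_sum hb).trans ?_
  simp

/-- Potter type bounds -/
lemma lt_potter (G : ℝ → ℝ) (hanti : Antitone G) (hpos : ∀ x > 0, 0 < G x) (α : ℝ) (hα : 1 < α)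
    (hG : ∀ η > 1, Tendsto (fun x : ℝ => G (η * x) / G x) atTop (nhds (η ^ (-α)))) :
    ∃ β : ℝ, 1 < β ∧ ∃ x₀ : ℝ, 0 < x₀ ∧ (∀ x ≥ x₀, ∀ j : ℕ, G (2 ^ j * x) ≤ ((2:ℝ) ^ (-β)) ^ j * G x) ∧
      (∃ c > 0, ∀ x ≥ x₀, G x ≤ c * x ^ (-β)) ∧ (∃ c > 0, ∀ x ≥ x₀, c * x ^ (-(α+1)) ≤ G x) := by
  have h2 := hG 2 (by norm_num)
  have e1 : ∀ᶠ x in atTop, G (2 * x) / G x < (2:ℝ) ^ (-((1+α)/2)) :=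
    h2.eventually_lt_const (Real.rpow_lt_rpow_of_exponent_lt (by norm_num) (by linarith))
  have e2 : ∀ᶠ x in atTop, (2:ℝ) ^ (-(α+1)) < G (2 * x) / G x :=
    h2.eventually_const_lt (Real.rpow_lt_rpow_of_exponent_lt (by norm_num) (by linarith))
  obtain ⟨y, hy⟩ := eventually_atTop.1 (e1.and e2)
  have hx0 : 0 < max y 1 := by positivity
  have step1 : ∀ x ≥ max y 1, ∀ j : ℕ, G (2 ^ j * x) ≤ ((2:ℝ) ^ (-((1+α)/2))) ^ j * G x := by
    intro x hx j
    have hxp : 0 < x := hx0.trans_le hx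
    induction j with
    | zero => simp
    | succ j ih =>
      have hge : 2 ^ j * x ≥ y := by
        have : (1:ℝ) ≤ 2 ^ j := one_le_pow₀ (by norm_num)
        have := le_max_left y 1
        nlinarith
      have := (hy _ hge).1
      rw [div_lt_iff₀ (hpos _ (by positivity))] at this
      rw [pow_succ', mul_assoc, pow_succ', mul_assoc]
      exact this.le.trans (by gcongr)
  have step2 : ∀ x ≥ max y 1, ∀ j : ℕ, ((2:ℝ) ^ (-(α+1))) ^ j * G x ≤ G (2 ^ j * x) := by
    intro x hx j
    have hxp : 0 < x := hx0.trans_le hx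
    induction j with
    | zero => simp
    | succ j ih =>
      have hge : 2 ^ j * x ≥ y := by
        have : (1:ℝ) ≤ 2 ^ j := one_le_pow₀ (by norm_num)
        have := le_max_left y 1
        nlinarith
      have := (hy _ hge).2
      rw [lt_div_iff₀ (hpos _ (by positivity))] at this
      rw [pow_succ', mul_assoc, pow_succ', mul_assoc]
      refine le_trans (by gcongr) this.le
  refine ⟨(1+α)/2, by linarith, max y 1, hx0, step1, ?_, ?_⟩
  · set x₀ := max y 1
    set β := (1+α)/2
    refine ⟨(2*x₀) ^ β * G x₀, mul_pos (by positivity) (hpos _ hx0), ?_⟩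
    intro x hx
    have hxp : 0 < x := hx0.trans_le hx
    obtain ⟨j, hj1, hj2⟩ := exists_nat_pow_near (x := x / x₀) (y := 2) ((one_le_div hx0).2 hx) (by norm_num)
    rw [le_div_iff₀ hx0] at hj1
    rw [div_lt_iff₀ hx0] at hj2
    refine (hanti hj1).trans ((step1 x₀ le_rfl j).trans ?_)
    rw [mul_right_comm]
    apply mul_le_mul_of_nonneg_right _ (hpos _ hx0).le
    rw [← Real.rpow_natCast, ← Real.rpow_mul (by norm_num), mul_comm, Real.rpow_mul (by norm_num), Real.rpow_natCast,
      Real.rpow_neg (by positivity), Real.rpow_neg (by positivity), ← div_eq_mul_inv, ← Real.div_rpow (by positivity) (by positivity), ← Real.inv_rpow (by positivity)]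
    apply Real.rpow_le_rpow (by positivity) _ (by simp only [β]; linarith)
    rw [inv_le_comm₀ (by positivity) (by positivity), inv_div, div_le_iff₀ (by positivity)]
    rw [pow_succ] at hj2; linarith
  · set x₀ := max y 1
    refine ⟨x₀ ^ (α+1) * G (2*x₀), mul_pos (by positivity) (hpos _ (by positivity)), ?_⟩
    intro x hx
    have hxp : 0 < x := hx0.trans_le hx
    obtain ⟨j, hj1, hj2⟩ := exists_nat_pow_near (x := x / x₀) (y := 2) ((one_le_div hx0).2 hx) (by norm_num)
    rw [le_div_iff₀ hx0] at hj1
    rw [div_lt_iff₀ hx0] at hj2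
    have : x ≤ 2 ^ j * (2 * x₀) := by rw [pow_succ] at hj2; linarith
    refine le_trans ?_ ((step2 (2*x₀) (by linarith) j).trans (hanti this))
    rw [mul_right_comm]
    apply mul_le_mul_of_nonneg_right _ (hpos _ (by positivity)).le
    rw [← Real.rpow_natCast, ← Real.rpow_mul (by norm_num), mul_comm _ (j:ℝ), Real.rpow_mul (by norm_num), Real.rpow_natCast,
      Real.rpow_neg (by positivity), Real.rpow_neg (by positivity), ← div_eq_mul_inv, ← Real.div_rpow (by positivity) (by positivity), ← Real.inv_rpow (by positivity)]
    apply Real.rpow_le_rpow (by positivity) _ (by linarith)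
    rw [le_inv_comm₀ (by positivity) (by positivity), inv_div, le_div_iff₀ (by positivity)]
    linarith

lemma lt_dom {Ω : Type*} [MeasurableSpace Ω] (μ : Measure Ω) [IsProbabilityMeasure μ]
    (Y : Ω → ℝ) (hY : Measurable Y) (hint : Integrable Y μ) (h : ℕ → ℝ) (hpos : ∀ᶠ n in atTop, 0 < h n)
    (hlim : Tendsto h atTop (nhds 0)) :
    Tendsto (fun n => ∫ ω, (if h n * Y ω ≤ 1 then (Real.exp (h n * Y ω) - 1) / h n else 0) ∂μ) atTop (nhds (∫ ω, Y ω ∂μ)) := by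
  apply tendsto_integral_filter_of_dominated_convergence (fun ω => Real.exp 1 * |Y ω|)
  · refine Eventually.of_forall fun n => Measurable.aestronglyMeasurable ?_
    exact Measurable.ite (measurableSet_le (by fun_prop) (by fun_prop)) (by fun_prop) (by fun_prop)
  · filter_upwards [hpos] with n hn
    refine Eventually.of_forall fun ω => ?_
    split_ifs with h1
    · rw [Real.norm_eq_abs, abs_div, abs_of_pos hn, div_le_iff₀ hn]
      have key : ∀ u : ℝ, u ≤ 1 → |Real.exp u - 1| ≤ Real.exp 1 * |u| := by
        intro u hu
        have e1 := Real.add_one_le_exp u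
        have e3 := Real.add_one_le_exp (-u)
        have e2 : (2:ℝ) ≤ Real.exp 1 := by have := Real.add_one_le_exp (1:ℝ); linarith
        rcases le_total 0 u with hu0 | hu0
        · rw [abs_of_nonneg (by linarith), abs_of_nonneg hu0]
          have : Real.exp u * Real.exp (-u) = 1 := by rw [← Real.exp_add]; simp
          have h4 : Real.exp u - 1 ≤ Real.exp u * u := by nlinarith [Real.exp_pos u]
          exact h4.trans (by gcongr)
        · have : Real.exp u ≤ 1 := by simpa using hu0
          rw [abs_of_nonpos (by linarith), abs_of_nonpos hu0]
          nlinarith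
      have := key _ h1
      rw [abs_mul, abs_of_pos hn] at this
      linarith
    · simp; positivity
  · exact hint.abs.const_mul _
  · refine Eventually.of_forall fun ω => ?_
    have hd : HasDerivAt (fun t => Real.exp (t * Y ω)) (Y ω) 0 := by
      simpa using (((hasDerivAt_id (0:ℝ)).mul_const (Y ω)).exp)
    have hs := hd.tendsto_slope_zero
    have ht : Tendsto h atTop (nhdsWithin 0 {0}ᶜ) := by
      rw [tendsto_nhdsWithin_iff]
      exact ⟨hlim, hpos.mono fun n hn => hn.ne'⟩
    refine (hs.comp ht).congr' ?_
    have : Tendsto (fun n => h n * Y ω) atTop (nhds 0) := by simpa using hlim.mul_const (Y ω)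
    filter_upwards [this.eventually_lt_const one_pos] with n hn
    rw [if_pos hn.le]
    simp [div_eq_inv_mul]

lemma lt_expmom {Ω : Type*} [MeasurableSpace Ω] (μ : Measure Ω) [IsProbabilityMeasure μ]
    (Y : Ω → ℝ) (hY : Measurable Y) (hint : Integrable Y μ) (δ : ℝ) (hδ : 0 < δ)
    (hmean : ∫ ω, Y ω ∂μ = -δ) (β x₀ c : ℝ) (hβ : 1 < β) (hc : 0 < c)
    (hup : ∀ x ≥ x₀, (μ {ω | x < Y ω}).toReal ≤ c * x ^ (-β)) (K ε : ℝ) (hK : 0 < K) (hε : 0 < ε)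
    (hKε : K * ε ≤ (β - 1) / 2) :
    ∀ᶠ n : ℕ in atTop, ∫⁻ ω, ENNReal.ofReal (Real.exp ((K * Real.log n / n) * min (Y ω) (ε * n))) ∂μ
      ≤ ENNReal.ofReal (1 - (K * Real.log n / n) * δ / 2) := by
  set h : ℕ → ℝ := fun n => K * Real.log n / n with hdef
  have hposev : ∀ᶠ n in atTop, 0 < h n := by
    filter_upwards [eventually_ge_atTop 2] with n hn
    have : (1:ℝ) < n := by exact_mod_cast hn
    have := Real.log_pos this
    simp only [hdef]; positivity
  have hlogpow : ∀ r : ℝ, 0 < r → Tendsto (fun n : ℕ => Real.log n / (n:ℝ) ^ r) atTop (nhds 0) := by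
    intro r hr
    exact ((isLittleO_log_rpow_atTop hr).tendsto_div_nhds_zero).comp tendsto_natCast_atTop_atTop
  have hlim : Tendsto h atTop (nhds 0) := by
    have := (hlogpow 1 one_pos).const_mul K
    simp only [Real.rpow_one, mul_zero] at this
    refine this.congr fun n => ?_
    simp only [hdef]; ring
  have hdom := lt_dom μ Y hY hint h hposev hlim
  rw [hmean] at hdom
  have e1 := hdom.eventually_lt_const (show -δ < -(3*δ/4) by linarith)
  have e2 : ∀ᶠ n : ℕ in atTop, c * (n:ℝ) ^ ((β-1)/2) * (h n) ^ (β - 1) < δ / 4 := by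
    have ht : Tendsto (fun n : ℕ => c * (K * (Real.log n / (n:ℝ) ^ (1/2:ℝ))) ^ (β - 1)) atTop (nhds 0) := by
      have := (((hlogpow (1/2) (by norm_num)).const_mul K).rpow_const (p := β - 1) (Or.inr (by linarith))).const_mul c
      simpa [Real.zero_rpow (show β - 1 ≠ 0 by linarith)] using this
    filter_upwards [ht.eventually_lt_const (show 0 < δ/4 by linarith), eventually_ge_atTop 1] with n hn hn1
    refine lt_of_eq_of_lt ?_ hn
    have hn0 : (0:ℝ) < n := by exact_mod_cast hn1
    have hl : 0 ≤ Real.log n := Real.log_natCast_nonneg n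
    rw [mul_assoc]
    congr 1
    have : (n:ℝ) ^ ((β-1)/2) = ((n:ℝ) ^ (1/2:ℝ)) ^ (β - 1) := by
      rw [← Real.rpow_mul hn0.le]; congr 1; ring
    rw [this, ← Real.mul_rpow (by positivity) (by simp only [hdef]; positivity)]
    congr 1
    simp only [hdef]
    have h2 : (n:ℝ) ^ (1/2:ℝ) * (n:ℝ) ^ (1/2:ℝ) = n := by
      rw [← Real.rpow_add hn0]; norm_num
    have h3 : (n:ℝ) ^ (1/2:ℝ) ≠ 0 := by positivity
    rw [mul_div_assoc', mul_div_assoc', div_eq_div_iff hn0.ne' h3]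
    linear_combination (K * Real.log n) * h2
  have e3 : ∀ᶠ n in atTop, x₀ ≤ (h n)⁻¹ := by
    have : Tendsto (fun n => (h n)⁻¹) atTop atTop := by
      apply Tendsto.inv_tendsto_nhdsGT_zero
      rw [tendsto_nhdsWithin_iff]
      exact ⟨hlim, hposev⟩
    exact this.eventually_ge_atTop x₀
  filter_upwards [hposev, e1, e2, e3, eventually_ge_atTop 1] with n hh e1 e2 e3 hn1
  have hn0 : (0:ℝ) < n := by exact_mod_cast hn1
  change ∫⁻ ω, ENNReal.ofReal (Real.exp (h n * min (Y ω) (ε * n))) ∂μ ≤ ENNReal.ofReal (1 - h n * δ / 2)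
  set φ : Ω → ℝ := fun ω => if h n * Y ω ≤ 1 then (Real.exp (h n * Y ω) - 1) / h n else 0 with hφ
  have hs : MeasurableSet {ω | (h n)⁻¹ < Y ω} := measurableSet_lt measurable_const hY
  have hφi : Integrable φ μ := by
    refine Integrable.of_bound (Measurable.aestronglyMeasurable ?_) (Real.exp 1 / h n) (Eventually.of_forall fun ω => ?_)
    · exact Measurable.ite (measurableSet_le (by fun_prop) (by fun_prop)) (by fun_prop) (by fun_prop)
    · simp only [hφ]
      split_ifs with h1
      · rw [Real.norm_eq_abs, abs_div, abs_of_pos hh]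
        gcongr
        rw [abs_le]
        have := Real.exp_pos (h n * Y ω)
        have := Real.exp_le_exp.2 h1
        have := Real.add_one_le_exp (1:ℝ)
        constructor <;> linarith
      · simp; positivity
  have hexp : h n * (ε * n) = K * ε * Real.log n := by
    simp only [hdef]; field_simp
  have hi1 : Integrable (fun ω => Real.exp (h n * min (Y ω) (ε * n))) μ := by
    refine Integrable.of_bound (Measurable.aestronglyMeasurable (by fun_prop)) (Real.exp (h n * (ε * n))) (Eventually.of_forall fun ω => ?_)
    rw [Real.norm_eq_abs, abs_of_pos (Real.exp_pos _)]
    gcongr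
    exact min_le_right _ _
  have hi2 : Integrable ({ω | (h n)⁻¹ < Y ω}.indicator (fun _ => (n:ℝ) ^ ((β-1)/2))) μ :=
    (integrable_const _).indicator hs
  rw [← ofReal_integral_eq_lintegral_ofReal hi1 (Eventually.of_forall fun ω => (Real.exp_pos _).le)]
  apply ENNReal.ofReal_le_ofReal
  have hle : ∫ ω, Real.exp (h n * min (Y ω) (ε * n)) ∂μ ≤
      ∫ ω, ((1 + h n * φ ω) + {ω | (h n)⁻¹ < Y ω}.indicator (fun _ => (n:ℝ) ^ ((β-1)/2)) ω) ∂μ := by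
    refine integral_mono hi1 (((integrable_const _).add (hφi.const_mul _)).add hi2) fun ω => ?_
    simp only [hφ]
    have hiff : (h n)⁻¹ < Y ω ↔ ¬ (h n * Y ω ≤ 1) := by
      rw [not_le, inv_lt_iff_one_lt_mul₀ hh, mul_comm]
    by_cases h1 : h n * Y ω ≤ 1
    · rw [if_pos h1, Set.indicator_of_notMem (by simp only [Set.mem_ofPred_eq]; tauto)]
      rw [mul_div_cancel₀ _ hh.ne']
      have : Real.exp (h n * min (Y ω) (ε * n)) ≤ Real.exp (h n * Y ω) := by
        gcongr; exact min_le_left _ _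
      linarith
    · rw [if_neg h1, Set.indicator_of_mem (by simp only [Set.mem_ofPred_eq]; tauto)]
      have : Real.exp (h n * min (Y ω) (ε * n)) ≤ Real.exp (h n * (ε * n)) := by
        gcongr; exact min_le_right _ _
      rw [hexp, mul_comm (K * ε), ← Real.rpow_def_of_pos hn0] at this
      have h4 : (n:ℝ) ^ (K * ε) ≤ (n:ℝ) ^ ((β-1)/2) :=
        Real.rpow_le_rpow_of_exponent_le (by exact_mod_cast hn1) hKε
      linarith
  refine hle.trans ?_
  have hi3 : Integrable (fun ω => 1 + h n * φ ω) μ := (integrable_const _).add (hφi.const_mul _)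
  rw [integral_add hi3 hi2, integral_add (integrable_const _) (hφi.const_mul _),
    integral_indicator_const _ hs, integral_const_mul]
  simp only [integral_const, probReal_univ, smul_eq_mul, one_mul]
  have hp : μ.real {ω | (h n)⁻¹ < Y ω} ≤ c * (h n) ^ β := by
    have := hup _ e3
    rwa [Real.inv_rpow hh.le, Real.rpow_neg hh.le, inv_inv] at this
  have hb : (h n) ^ β = (h n) ^ (β - 1) * h n := by
    rw [← Real.rpow_add_one hh.ne']; congr 1; ring
  rw [hb] at hp
  have h5 : μ.real {ω | (h n)⁻¹ < Y ω} * (n:ℝ) ^ ((β-1)/2) ≤ (c * (n:ℝ) ^ ((β-1)/2) * (h n) ^ (β - 1)) * h n := by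
    refine (mul_le_mul_of_nonneg_right hp (by positivity)).trans (le_of_eq (by ring))
  have h6 := mul_lt_mul_of_pos_right e2 hh
  have h7 := mul_lt_mul_of_pos_left e1 hh
  linarith

lemma lt_block {Ω : Type*} [MeasurableSpace Ω] (μ : Measure Ω) [IsProbabilityMeasure μ]
    (X : ℕ → Ω → ℝ) (hmeas : ∀ n, Measurable (X n)) (m : ℕ)
    (hlaw : ∀ i, μ.map (X i) = μ.map (X 0))
    (hmdep : ∀ n : ℕ, ProbabilityTheory.Indep
        (MeasurableSpace.comap (X n) inferInstance)
        (⨆ i ∈ {i : ℕ | i + m < n}, MeasurableSpace.comap (X i) inferInstance) μ)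
    (hint : Integrable (X 0) μ)
    (δ : ℝ) (hδ : 0 < δ) (hmean : ∫ ω, X 0 ω ∂μ = -δ)
    (α : ℝ) (hα : 1 < α) (G : ℝ → ℝ) (hGdef : ∀ x, G x = (μ {ω | x < X 0 ω}).toReal)
    (hpos : ∀ x > 0, 0 < G x)
    (hG : ∀ η > 1, Tendsto (fun x : ℝ => G (η * x) / G x) atTop (nhds (η ^ (-α))))
    (β x₀ c c' : ℝ) (hβ : 1 < β) (hc : 0 < c) (hc' : 0 < c')
    (hup : ∀ x ≥ x₀, G x ≤ c * x ^ (-β)) (hlow : ∀ x ≥ x₀, c' * x ^ (-(α+1)) ≤ G x) :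
    ∃ C > 0, ∀ᶠ N : ℕ in atTop, μ {ω | ∃ n : ℕ, N ≤ n ∧ n < 2 * N ∧ 0 < ∑ i ∈ Finset.range n, X i ω}
      ≤ ENNReal.ofReal (C * (N * G N)) := by
  set d : ℝ := (m:ℝ) + 1 with hd
  have hd0 : 0 < d := by positivity
  set K : ℝ := 4 * d * (α + 1) / δ with hKd
  have hK : 0 < K := by have : 0 < α + 1 := by linarith
                        positivity
  set ε : ℝ := min (1/2) ((β - 1) / (2 * K)) with hεd
  have hε : 0 < ε := lt_min (by norm_num) (div_pos (by linarith) (by positivity))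
  have hε1 : ε < 1 := (min_le_left _ _).trans_lt (by norm_num)
  have hKε : K * ε ≤ (β - 1) / 2 := by
    have : ε ≤ (β - 1) / (2 * K) := min_le_right _ _
    rw [le_div_iff₀ (by positivity)] at this
    linarith
  have hmom := lt_expmom μ (X 0) (hmeas 0) hint δ hδ hmean β x₀ c hβ hc
    (fun x hx => by rw [← hGdef]; exact hup x hx) K ε hK hε hKε
  set η := ε⁻¹ with hη
  have hη1 : 1 < η := (one_lt_inv₀ hε).2 hε1
  set A : ℝ := 2 * η ^ α with hA
  have hA0 : 0 < A := by positivity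
  have e1 : ∀ᶠ N : ℕ in atTop, G (ε * N) ≤ A * G N := by
    have h1 : ∀ᶠ x in atTop, η ^ (-α) / 2 < G (η * x) / G x :=
      (hG η hη1).eventually_const_lt (half_lt_self (by positivity))
    have h2 : Tendsto (fun N : ℕ => ε * (N:ℝ)) atTop atTop :=
      tendsto_natCast_atTop_atTop.const_mul_atTop hε
    filter_upwards [h2.eventually h1, eventually_ge_atTop 1] with N hN hN1
    have hN0 : (0:ℝ) < N := by exact_mod_cast hN1
    rw [lt_div_iff₀ (hpos _ (by positivity)), hη, inv_mul_cancel_left₀ hε.ne', ← hη, Real.rpow_neg (by positivity)] at hN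
    have : η ^ α * ((η ^ α)⁻¹ / 2 * G (ε * N)) ≤ η ^ α * G N := by gcongr
    have h3 : η ^ α ≠ 0 := by positivity
    have h4 : η ^ α * ((η ^ α)⁻¹ / 2 * G (ε * N)) = G (ε * N) / 2 := by field_simp
    rw [hA]; linarith
  refine ⟨2 * A + d / c', by positivity, ?_⟩
  have e2 : ∀ᶠ N : ℕ in atTop, x₀ ≤ (N:ℝ) := tendsto_natCast_atTop_atTop.eventually_ge_atTop x₀
  filter_upwards [hmom, e1, e2, eventually_ge_atTop (m+1), eventually_ge_atTop 2] with N hE e1 e2 hNm hN2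
  have hN1 : (1:ℝ) < N := by exact_mod_cast hN2
  have hlog := Real.log_pos hN1
  set h : ℝ := K * Real.log N / N with hh
  have hh0 : 0 < h := by positivity
  have hsub : {ω | ∃ n : ℕ, N ≤ n ∧ n < 2 * N ∧ 0 < ∑ i ∈ Finset.range n, X i ω} ⊆
      (⋃ i ∈ Finset.range (2 * N), {ω | ε * N < X i ω}) ∪
      ⋃ n ∈ Finset.Ico N (2 * N), {ω | 0 < ∑ i ∈ Finset.range n, min (X i ω) (ε * N)} := by
    rintro ω ⟨n, hn1, hn2, hS⟩
    by_cases hb : ∃ i ∈ Finset.range (2 * N), ε * N < X i ω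
    · left
      simpa only [Set.mem_iUnion, exists_prop, Set.mem_ofPred_eq] using hb
    · right
      push Not at hb
      simp only [Set.mem_iUnion, exists_prop, Set.mem_ofPred_eq]
      refine ⟨n, Finset.mem_Ico.2 ⟨hn1, hn2⟩, ?_⟩
      rw [Finset.sum_congr rfl fun i hi => min_eq_left (hb i ?_)]
      · exact hS
      · simp only [Finset.mem_range] at hi ⊢; omega
  have hA1 : μ (⋃ i ∈ Finset.range (2 * N), {ω | ε * N < X i ω}) ≤ ENNReal.ofReal (2 * N * G (ε * N)) := by
    refine (measure_biUnion_finset_le _ _).trans ?_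
    have : ∀ i ∈ Finset.range (2 * N), μ {ω | ε * N < X i ω} ≤ ENNReal.ofReal (G (ε * N)) := by
      intro i _
      have hm : ∀ k, μ {ω | ε * N < X k ω} = μ.map (X k) (Set.Ioi (ε * N)) := fun k => by
        rw [Measure.map_apply (hmeas k) measurableSet_Ioi]; rfl
      rw [hGdef, ENNReal.ofReal_toReal (measure_ne_top _ _), hm i, hlaw i, ← hm 0]
    refine (Finset.sum_le_sum this).trans ?_
    rw [Finset.sum_const, Finset.card_range, nsmul_eq_mul, ENNReal.ofReal_mul (by positivity)]
    gcongr
    rw [← ENNReal.ofReal_natCast]; push_cast; rfl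
  have hA2 : μ (⋃ n ∈ Finset.Ico N (2 * N), {ω | 0 < ∑ i ∈ Finset.range n, min (X i ω) (ε * N)}) ≤
      ENNReal.ofReal (N * (d * (N:ℝ) ^ (-(α+1)))) := by
    refine (measure_biUnion_finset_le _ _).trans ?_
    have : ∀ n ∈ Finset.Ico N (2 * N), μ {ω | 0 < ∑ i ∈ Finset.range n, min (X i ω) (ε * N)} ≤
        ENNReal.ofReal (d * (N:ℝ) ^ (-(α+1))) := by
      intro n hn
      have hE' := hE.trans (ENNReal.ofReal_le_ofReal (show 1 - h * δ / 2 ≤ Real.exp (-(h * δ / 2)) by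
        have := Real.add_one_le_exp (-(h * δ / 2)); linarith))
      refine (lt_chernoff μ X hmeas m hlaw hmdep h (ε * N) (Real.exp (-(h * δ / 2))) hh0.le
        (by rw [Real.exp_le_one_iff]; have : 0 < h * δ := by positivity
            linarith) hE' n).trans ?_
      rw [ENNReal.ofReal_mul hd0.le, ← ENNReal.ofReal_pow (Real.exp_pos _).le]
      have hdm : ENNReal.ofReal d = (m:ENNReal) + 1 := by
        rw [hd, ENNReal.ofReal_add (by positivity) (by norm_num)]; simp
      rw [hdm]
      gcongr
      rw [← Real.exp_nat_mul, Real.rpow_def_of_pos (by positivity)]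
      apply Real.exp_le_exp.2
      have hk : N < (n / (m+1) + 1) * (m+1) := by
        have h1 := (Finset.mem_Ico.1 hn).1
        have h2 := Nat.lt_div_mul_add (a := n) (Nat.succ_pos m)
        simp only [Nat.succ_eq_add_one] at h2
        rw [add_mul, one_mul]; omega
      have hk1 : 1 ≤ n / (m+1) := by
        have h1 := (Finset.mem_Ico.1 hn).1
        exact (Nat.one_le_div_iff (Nat.succ_pos m)).2 (by omega)
      set k := n / (m+1)
      have hk' : (N:ℝ) < (k + 1) * d := by rw [hd]; exact_mod_cast hk
      have hk1' : (1:ℝ) ≤ k := by exact_mod_cast hk1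
      have hk2 : (N:ℝ) ≤ 2 * k * d := by nlinarith
      have hhd : h * δ / 2 * N = 2 * d * (α + 1) * Real.log N := by
        rw [hh, hKd]; field_simp; ring
      have h8 : h * δ / 2 * N ≤ h * δ / 2 * (2 * k * d) := by gcongr
      rw [hhd] at h8
      have h9 : (α+1) * Real.log N ≤ h * δ / 2 * k := by
        have : (2 * d) * ((α+1) * Real.log N) ≤ (2 * d) * (h * δ / 2 * k) := by linarith
        exact le_of_mul_le_mul_left this (by positivity)
      linarith
    refine (Finset.sum_le_sum this).trans ?_
    rw [Finset.sum_const, Nat.card_Ico, nsmul_eq_mul,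
      ENNReal.ofReal_mul (p := (N:ℝ)) (by positivity), show 2 * N - N = N by omega,
      ENNReal.ofReal_natCast]
  refine (measure_mono hsub).trans ((measure_union_le _ _).trans ((add_le_add hA1 hA2).trans ?_))
  have hG0 : ∀ x, 0 ≤ G x := fun x => by rw [hGdef]; exact ENNReal.toReal_nonneg
  rw [← ENNReal.ofReal_add (mul_nonneg (by positivity) (hG0 _)) (by positivity)]
  apply ENNReal.ofReal_le_ofReal
  have h1 : (N:ℝ) ^ (-(α+1)) ≤ G N / c' := by
    rw [le_div_iff₀ hc', mul_comm]; exact hlow _ e2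
  have h2 : (N:ℝ) * (d * (N:ℝ) ^ (-(α+1))) ≤ N * (d * (G N / c')) := by gcongr
  have h3 : 2 * (N:ℝ) * G (ε * N) ≤ 2 * N * (A * G N) := by gcongr
  calc _ ≤ 2 * N * (A * G N) + N * (d * (G N / c')) := add_le_add h3 h2
    _ = _ := by ring

lemma lt_late {Ω : Type*} [MeasurableSpace Ω] (μ : Measure Ω) [IsProbabilityMeasure μ]
    (X : ℕ → Ω → ℝ) (G : ℝ → ℝ) (hG0 : ∀ x, 0 ≤ G x) 
    (β x₀ C : ℝ) (hβ : 1 < β) (hC : 0 < C)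
    (hpot : ∀ x ≥ x₀, ∀ j : ℕ, G (2 ^ j * x) ≤ ((2:ℝ) ^ (-β)) ^ j * G x)
    (hblock : ∀ᶠ N : ℕ in atTop, μ {ω | ∃ n : ℕ, N ≤ n ∧ n < 2 * N ∧ 0 < ∑ i ∈ Finset.range n, X i ω}
      ≤ ENNReal.ofReal (C * (N * G N))) :
    ∃ D > 0, ∀ᶠ N : ℕ in atTop, (μ {ω | ∃ n : ℕ, N ≤ n ∧ 0 < ∑ i ∈ Finset.range n, X i ω}).toReal
      ≤ D * (N * G N) := by
  set r : ℝ := 2 * (2:ℝ) ^ (-β) with hr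
  have hr0 : 0 < r := by positivity
  have hr1 : r < 1 := by
    have : (2:ℝ) ^ (-β) < (2:ℝ) ^ (-1:ℝ) := Real.rpow_lt_rpow_of_exponent_lt (by norm_num) (by linarith)
    rw [Real.rpow_neg_one] at this
    rw [hr]; linarith
  refine ⟨C * (1 - r)⁻¹, mul_pos hC (inv_pos.2 (by linarith)), ?_⟩
  obtain ⟨N₀, hN₀⟩ := eventually_atTop.1 hblock
  have e2 : ∀ᶠ N : ℕ in atTop, x₀ ≤ (N:ℝ) := tendsto_natCast_atTop_atTop.eventually_ge_atTop x₀
  filter_upwards [eventually_ge_atTop N₀, eventually_ge_atTop 1, e2] with N hN hN1 hNx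
  have hG0N := hG0 N
  have hsub : {ω | ∃ n : ℕ, N ≤ n ∧ 0 < ∑ i ∈ Finset.range n, X i ω} ⊆
      ⋃ j : ℕ, {ω | ∃ n : ℕ, 2 ^ j * N ≤ n ∧ n < 2 * (2 ^ j * N) ∧ 0 < ∑ i ∈ Finset.range n, X i ω} := by
    rintro ω ⟨n, hn, hS⟩
    have hk : 1 ≤ n / N := (Nat.one_le_div_iff hN1).2 hn
    have h1 := Nat.pow_log_le_self 2 (show n / N ≠ 0 by omega)
    have h2 := Nat.lt_pow_succ_log_self (b := 2) (by norm_num) (n / N)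
    refine Set.mem_iUnion.2 ⟨Nat.log 2 (n / N), n, ?_, ?_, hS⟩
    · exact (Nat.mul_le_mul_right N h1).trans (Nat.div_mul_le_self n N)
    · have h3 := Nat.lt_div_mul_add (a := n) (b := N) hN1
      rw [pow_succ] at h2
      have h4 : (n / N + 1) * N ≤ 2 ^ (Nat.log 2 (n / N)) * 2 * N := Nat.mul_le_mul_right N h2
      rw [add_mul, one_mul] at h4
      calc n < n / N * N + N := h3
        _ ≤ _ := h4
        _ = _ := by ring
  apply ENNReal.toReal_le_of_le_ofReal (mul_nonneg (mul_nonneg hC.le (inv_nonneg.2 (by linarith))) (by positivity))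
  refine (measure_mono hsub).trans ((measure_iUnion_le _).trans ?_)
  have hb : ∀ j : ℕ, μ {ω | ∃ n : ℕ, 2 ^ j * N ≤ n ∧ n < 2 * (2 ^ j * N) ∧ 0 < ∑ i ∈ Finset.range n, X i ω} ≤
      ENNReal.ofReal (C * (N * G N) * r ^ j) := by
    intro j
    have h1 : 1 ≤ 2 ^ j := Nat.one_le_two_pow
    refine (hN₀ (2 ^ j * N) (hN.trans (Nat.le_mul_of_pos_left N h1))).trans (ENNReal.ofReal_le_ofReal ?_)
    have := hpot N hNx j
    push_cast
    calc C * (2 ^ j * N * G (2 ^ j * N)) ≤ C * (2 ^ j * N * (((2:ℝ) ^ (-β)) ^ j * G N)) := by gcongr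
      _ = _ := by rw [hr, mul_pow]; ring
  refine (ENNReal.tsum_le_tsum hb).trans ?_
  have hsum : HasSum (fun j : ℕ => C * (N * G N) * r ^ j) (C * (N * G N) * (1 - r)⁻¹) :=
    (hasSum_geometric_of_lt_one hr0.le hr1).mul_left _
  rw [← ENNReal.ofReal_tsum_of_nonneg (fun j => by positivity) hsum.summable, hsum.tsum_eq]
  apply ENNReal.ofReal_le_ofReal
  apply le_of_eq; ring

/-- **Tail bound for the supremum of late partial sums of a stationary `m`-dependent
sequence with regularly varying marginals and negative mean.**
Here `X 0, X 1, …` represents `X_1, X_2, …`; `m`-dependence says each `X n` is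
independent of the σ-field generated by the variables more than `m` indices before it. -/
theorem late_supremum_tail_bound
    {Ω : Type*} [MeasurableSpace Ω] (μ : Measure Ω) [IsProbabilityMeasure μ]
    (X : ℕ → Ω → ℝ) (hmeas : ∀ n, Measurable (X n)) (m : ℕ)
    (hstat : μ.map (fun ω => fun n : ℕ => X (n + 1) ω)
        = μ.map (fun ω => fun n : ℕ => X n ω))
    (hmdep : ∀ n : ℕ, ProbabilityTheory.Indep
        (MeasurableSpace.comap (X n) inferInstance)
        (⨆ i ∈ {i : ℕ | i + m < n}, MeasurableSpace.comap (X i) inferInstance) μ)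
    (hint : Integrable (X 0) μ)
    (δ : ℝ) (hδ : 0 < δ) (hmean : ∫ ω, X 0 ω ∂μ = -δ)
    (α : ℝ) (hα : 1 < α) (l : ℝ → ℝ) (hlpos : ∀ x > 0, 0 < l x)
    (hlslow : ∀ η > 1, Tendsto (fun x : ℝ => l (η * x) / l x) atTop (nhds 1))
    (htail : ∀ x > 0, (μ {ω | x < X 0 ω}).toReal = l x / x ^ α) :
    ∃ C > 0, ∀ H : ℝ, 1 ≤ H →
      Filter.limsup (fun x : ℝ =>
          (μ {ω | ∃ n : ℕ, ⌈H * x⌉₊ ≤ n ∧ x < ∑ i ∈ Finset.range n, X i ω}).toReal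
            / ∫ u in Set.Ioi x, (μ {ω | u < X 0 ω}).toReal) atTop
        ≤ C / H ^ (α - 1) := by
  set G : ℝ → ℝ := fun x => (μ {ω | x < X 0 ω}).toReal with hGd
  have hG0 : ∀ x, 0 ≤ G x := fun x => ENNReal.toReal_nonneg
  have hanti : Antitone G := fun x y hxy =>
    ENNReal.toReal_mono (measure_ne_top _ _) (measure_mono fun ω (hω : y < X 0 ω) => lt_of_le_of_lt hxy hω)
  have hpos : ∀ x > 0, 0 < G x := fun x hx => by
    have h1 : G x = l x / x ^ α := htail x hx
    rw [h1]; exact div_pos (hlpos x hx) (by positivity)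
  have hG : ∀ η > 1, Tendsto (fun x : ℝ => G (η * x) / G x) atTop (nhds (η ^ (-α))) := by
    intro η hη
    have h1 := (hlslow η hη).mul_const (η ^ (-α))
    rw [one_mul] at h1
    refine h1.congr' ?_
    filter_upwards [eventually_gt_atTop 0] with x hx
    have hη0 : 0 < η := by linarith
    have h1 : G x = l x / x ^ α := htail x hx
    have h2 : G (η * x) = l (η * x) / (η * x) ^ α := htail _ (by positivity)
    have h3 := hlpos x hx
    rw [h1, h2, Real.mul_rpow hη0.le hx.le, Real.rpow_neg hη0.le]
    have h4 : 0 < x ^ α := by positivity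
    have h5 : 0 < η ^ α := by positivity
    field_simp
  obtain ⟨β, hβ, x₀, hx₀, hpot, ⟨c, hc, hup⟩, ⟨c', hc', hlow⟩⟩ := lt_potter G hanti hpos α hα hG
  have hlaw := lt_map_eq μ X hmeas hstat
  obtain ⟨C, hC, hblock⟩ := lt_block μ X hmeas m hlaw hmdep hint δ hδ hmean α hα G (fun _ => rfl) hpos hG
    β x₀ c c' hβ hc hc' hup hlow
  obtain ⟨D, hD, hlate⟩ := lt_late μ X G hG0 β x₀ C hβ hC hpot hblock
  refine ⟨2 * D * 2 ^ α, by positivity, fun H hH => ?_⟩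
  have hH0 : 0 < H := by linarith
  have hGH : Tendsto (fun x : ℝ => G (H * x) / G x) atTop (nhds (H ^ (-α))) := by
    rcases hH.eq_or_lt with rfl | hH1
    · rw [Real.one_rpow]
      refine tendsto_const_nhds.congr' ?_
      filter_upwards [eventually_gt_atTop 0] with x hx
      rw [one_mul, div_self (hpos x hx).ne']
    · exact hG H hH1
  have hv : Tendsto (fun x : ℝ => 2 * D * H * ((G (H * x) / G x) / (G (2 * x) / G x))) atTop
      (nhds (2 * D * H * (H ^ (-α) / 2 ^ (-α)))) :=
    (hGH.div (hG 2 (by norm_num)) (by positivity)).const_mul _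
  have hval : 2 * D * H * (H ^ (-α) / 2 ^ (-α)) = 2 * D * 2 ^ α / H ^ (α - 1) := by
    rw [Real.rpow_sub_one hH0.ne', Real.rpow_neg hH0.le, Real.rpow_neg (by norm_num)]
    have : 0 < H ^ α := by positivity
    field_simp
  rw [← hval, ← hv.limsup_eq]
  have hceil : Tendsto (fun x : ℝ => ⌈H * x⌉₊) atTop atTop :=
    tendsto_nat_ceil_atTop.comp (tendsto_id.const_mul_atTop hH0)
  refine limsup_le_limsup ?_ ?_ hv.isBoundedUnder_le
  · filter_upwards [hceil.eventually hlate, eventually_ge_atTop 1] with x hx hx1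
    have hx0 : 0 < x := by linarith
    have hGx := hpos x hx0
    have hG2x := hpos (2 * x) (by positivity)
    have hGHx := hpos (H * x) (by positivity)
    rw [div_div_div_cancel_right₀ hGx.ne']
    by_cases hi : IntegrableOn G (Set.Ioi x)
    · have hden : x * G (2 * x) ≤ ∫ u in Set.Ioi x, G u := by
        have h1 : ∫ u in Set.Ioc x (2 * x), G (2 * x) ≤ ∫ u in Set.Ioc x (2 * x), G u := by
          refine setIntegral_mono_on (by simp) (hi.mono_set Set.Ioc_subset_Ioi_self) measurableSet_Ioc ?_
          intro u hu
          exact hanti hu.2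
        have h2 : ∫ u in Set.Ioc x (2 * x), G u ≤ ∫ u in Set.Ioi x, G u :=
          setIntegral_mono_set hi (Eventually.of_forall hG0) (LE.le.eventuallyLE Set.Ioc_subset_Ioi_self)
        rw [setIntegral_const, smul_eq_mul, Real.volume_real_Ioc_of_le (by linarith)] at h1
        linarith
      have hnum : (μ {ω | ∃ n : ℕ, ⌈H * x⌉₊ ≤ n ∧ x < ∑ i ∈ Finset.range n, X i ω}).toReal ≤ 2 * D * H * x * G (H * x) := by
        refine (ENNReal.toReal_mono (measure_ne_top _ _) (measure_mono ?_)).trans (hx.trans ?_)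
        · rintro ω ⟨n, hn, hS⟩
          exact ⟨n, hn, hx0.trans hS⟩
        · have h1 : (⌈H * x⌉₊ : ℝ) ≤ 2 * (H * x) := by
            have := Nat.ceil_lt_add_one (show 0 ≤ H * x by positivity)
            nlinarith
          have h2 : G ⌈H * x⌉₊ ≤ G (H * x) := hanti (Nat.le_ceil _)
          have h3 := hG0 ⌈H * x⌉₊
          calc D * (⌈H * x⌉₊ * G ⌈H * x⌉₊) ≤ D * (2 * (H * x) * G (H * x)) := by gcongr
            _ = _ := by ring
      calc _ ≤ (2 * D * H * x * G (H * x)) / (x * G (2 * x)) := by gcongr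
        _ = _ := by field_simp
    · have : ∫ u in Set.Ioi x, G u = 0 := integral_undef hi
      simp only [this, div_zero]
      positivity
  · refine IsBoundedUnder.isCoboundedUnder_le ⟨0, ?_⟩
    rw [eventually_map]
    refine Eventually.of_forall fun x => ?_
    exact div_nonneg ENNReal.toReal_nonneg (integral_nonneg hG0)
end

section
/- Let 0 = T_0 < T_1 < T_2 < ... be strictly increasing arrival times, B_0 > 0 the size of the labeled job arriving at T_0, and let (B_{1,n})_{n≥1}, (B_{2,n})_{n≥1} be two sequences of nonnegative job sizes with B_{1,n} ∈ {0, B_{2,n}} for every n ≥ 1. Let w_1 = 0 ≤ w_2 be the initial priority workloads of the two systems. For j = 1, 2 define recursively, for n ≥ 0: R_j^0 = B_0, W_j^0 = w_j, and with Δ_n = T_{n+1} − T_n: R_j^{n+1} = max(R_j^n − (Δ_n − W_j^n)^+, 0), W_j^{n+1} = (W_j^n − Δ_n)^+ + B_{j,n+1}·1{B_{j,n+1} > 0 and B_{j,n+1} < R_j^{n+1}} (these are the remaining service time of the labeled job and the priority workload just after T_{n+1} under the shortest remaining processing time first discipline). Then for every n ≥ 0: R_1^n ≤ R_2^n and W_1^n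 ≤ W_2^n, and, defining for T_n ≤ t < T_{n+1} the remaining service R_j(t) = max(R_j^n − (t − T_n − W_j^n)^+, 0) and the sojourn time V_j = inf{t ≥ 0 : R_j(t) = 0}, one has R_1(t) ≤ R_2(t) for all t ≥ 0 and V_1 ≤ V_2. -/
open Filter

/-- **Sample-path monotonicity of SRPT.** Removing some of the competing jobs
(setting their sizes to `0`, with no initial priority workload) can only decrease
the labeled job's remaining service `R`, priority workload `W`, continuous-time
remaining service `Rc`, and sojourn time `V` (taken in `ℝ≥0∞`, with `inf ∅ = ∞`). -/
theorem srpt_sample_path_monotonicity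
    (T : ℕ → ℝ) (hT0 : T 0 = 0) (hTmono : StrictMono T) (hTtop : Tendsto T atTop atTop)
    (B0 : ℝ) (hB0 : 0 < B0)
    (B1 B2 : ℕ → ℝ)
    (hB2nn : ∀ n, 1 ≤ n → 0 ≤ B2 n)
    (hB1 : ∀ n, 1 ≤ n → B1 n = 0 ∨ B1 n = B2 n)
    (w2 : ℝ) (hw2 : 0 ≤ w2)
    (R1 R2 W1 W2 : ℕ → ℝ)
    (hR10 : R1 0 = B0) (hR20 : R2 0 = B0) (hW10 : W1 0 = 0) (hW20 : W2 0 = w2)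
    (hR1rec : ∀ n, R1 (n + 1) = max (R1 n - max (T (n + 1) - T n - W1 n) 0) 0)
    (hR2rec : ∀ n, R2 (n + 1) = max (R2 n - max (T (n + 1) - T n - W2 n) 0) 0)
    (hW1rec : ∀ n, W1 (n + 1) = max (W1 n - (T (n + 1) - T n)) 0 +
        (if 0 < B1 (n + 1) ∧ B1 (n + 1) < R1 (n + 1) then B1 (n + 1) else 0))
    (hW2rec : ∀ n, W2 (n + 1) = max (W2 n - (T (n + 1) - T n)) 0 +
        (if 0 < B2 (n + 1) ∧ B2 (n + 1) < R2 (n + 1) then B2 (n + 1) else 0))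
    (Rc1 Rc2 : ℝ → ℝ)
    (hRc1 : ∀ n, ∀ t, T n ≤ t → t < T (n + 1) →
        Rc1 t = max (R1 n - max (t - T n - W1 n) 0) 0)
    (hRc2 : ∀ n, ∀ t, T n ≤ t → t < T (n + 1) →
        Rc2 t = max (R2 n - max (t - T n - W2 n) 0) 0) :
    (∀ n, R1 n ≤ R2 n ∧ W1 n ≤ W2 n) ∧
    (∀ t, 0 ≤ t → Rc1 t ≤ Rc2 t) ∧
    (⨅ t : {t : ℝ // 0 ≤ t ∧ Rc1 t = 0}, ENNReal.ofReal t.1) ≤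
      ⨅ t : {t : ℝ // 0 ≤ t ∧ Rc2 t = 0}, ENNReal.ofReal t.1 := by
  have key : ∀ n, R1 n ≤ R2 n ∧ W1 n ≤ W2 n := by
    intro n
    induction n with
    | zero => rw [hR10, hR20, hW10, hW20]; exact ⟨le_refl _, hw2⟩
    | succ n ih =>
      obtain ⟨hR, hW⟩ := ih
      have hR' : R1 (n + 1) ≤ R2 (n + 1) := by
        rw [hR1rec, hR2rec]
        gcongr
      refine ⟨hR', ?_⟩
      rw [hW1rec, hW2rec]
      refine add_le_add (by gcongr) ?_
      have h2 := hB2nn (n + 1) (by omega)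
      rcases hB1 (n + 1) (by omega) with h | h
      · rw [h]
        split_ifs <;> linarith
      · rw [h]
        split_ifs with h3 h4
        · exact le_refl _
        · exact absurd ⟨h3.1, lt_of_lt_of_le h3.2 hR'⟩ h4
        · exact h2
        · exact le_refl _
  have loc : ∀ t, 0 ≤ t → ∃ n, T n ≤ t ∧ t < T (n + 1) := by
    intro t ht
    obtain ⟨m, hm⟩ := (hTtop.eventually_gt_atTop t).exists
    by_contra hcon
    push Not at hcon
    have hall : ∀ n, T n ≤ t := by
      intro n
      induction n with
      | zero => rw [hT0]; exact ht
      | succ n ih => exact hcon n ih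
    exact absurd (hall m) (not_le.mpr hm)
  have hc : ∀ t, 0 ≤ t → Rc1 t ≤ Rc2 t ∧ 0 ≤ Rc1 t := by
    intro t ht
    obtain ⟨n, h1, h2⟩ := loc t ht
    obtain ⟨hR, hW⟩ := key n
    rw [hRc1 n t h1 h2, hRc2 n t h1 h2]
    exact ⟨by gcongr, le_max_right _ _⟩
  refine ⟨key, fun t ht => (hc t ht).1, ?_⟩
  refine le_iInf ?_
  rintro ⟨t, ht, h0⟩
  exact iInf_le (fun t : {t : ℝ // 0 ≤ t ∧ Rc1 t = 0} => ENNReal.ofReal t.1)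
    ⟨t, ht, le_antisymm (h0 ▸ (hc t ht).1) (hc t ht).2⟩
end
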